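/- arXiv:2209.04474 — 2 statements merged into one kernel-verified Lean document; each statement's English description precedes it below -/
import Mathlib

section
/- Let U = {u ∈ ℝ^(X × A) : u(x,a) ≥ 0 for all (x,a), and ⟨u, P⟩ = 1 for all P ∈ S_NS} be the polytope of non-negative representations of the identity effect. For every extremal effect vector e there exist an extreme point u of U and a vector e' ∈ ℝ^(X × A) with e'(x,a) ∈ {0, u(x,a)} for every (x,a) (i.e., e' is formed from u by replacing some of the non-zero entries with 0s), such that ⟨e', P⟩ = ⟨e, P⟩ for every P ∈ S_NS. -/
open Finset

/-- The standard inner product on `ℝ^(X × A)`. -/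
def ip {N nI nO : ℕ} (e P : (Fin N → Fin nI) → (Fin N → Fin nO) → ℝ) : ℝ :=
  ∑ x : Fin N → Fin nI, ∑ a : Fin N → Fin nO, e x a * P x a

/-- The single-party no-signalling conditions. -/
def NoSig (N nI nO : ℕ) (P : (Fin N → Fin nI) → (Fin N → Fin nO) → ℝ) : Prop :=
  ∀ i : Fin N, ∀ x x' : Fin N → Fin nI, (∀ j, j ≠ i → x j = x' j) →
    ∀ a : Fin N → Fin nO,
      ∑ b : Fin nO, P x (Function.update a i b) =
      ∑ b : Fin nO, P x' (Function.update a i b)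

/-- The state space of no-signalling behaviours. -/
def SNS (N nI nO : ℕ) (P : (Fin N → Fin nI) → (Fin N → Fin nO) → ℝ) : Prop :=
  NoSig N nI nO P ∧ (∀ x a, 0 ≤ P x a) ∧
    (∀ x : Fin N → Fin nI, ∑ a : Fin N → Fin nO, P x a = 1)

/-- Effect vectors: `0 ≤ ⟨e, P⟩ ≤ 1` on all no-signalling states. -/
def IsEffect (N nI nO : ℕ) (e : (Fin N → Fin nI) → (Fin N → Fin nO) → ℝ) : Prop :=
  ∀ P, SNS N nI nO P → 0 ≤ ip e P ∧ ip e P ≤ 1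

/-- Extremal effect vectors. -/
def IsExtremalEffect (N nI nO : ℕ) (e : (Fin N → Fin nI) → (Fin N → Fin nO) → ℝ) : Prop :=
  IsEffect N nI nO e ∧
  ∀ e₁ e₂ : (Fin N → Fin nI) → (Fin N → Fin nO) → ℝ, ∀ α : ℝ,
    IsEffect N nI nO e₁ → IsEffect N nI nO e₂ → 0 < α → α < 1 →
    (∀ P, SNS N nI nO P → ip e P = α * ip e₁ P + (1 - α) * ip e₂ P) →
    (∀ P, SNS N nI nO P → ip e₁ P = ip e P ∧ ip e₂ P = ip e P)

section Helpers

variable {N nI nO : ℕ}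

/-- The ambient space `ℝ^(X × A)`. -/
abbrev Vec (N nI nO : ℕ) : Type := (Fin N → Fin nI) → (Fin N → Fin nO) → ℝ

lemma ip_add_left (e f P : Vec N nI nO) : ip (e + f) P = ip e P + ip f P := by
  simp [ip, add_mul, sum_add_distrib]

lemma ip_sub_left (e f P : Vec N nI nO) : ip (e - f) P = ip e P - ip f P := by
  simp [ip, sub_mul, sum_sub_distrib]

lemma ip_smul_left (c : ℝ) (e P : Vec N nI nO) : ip (c • e) P = c * ip e P := by
  simp [ip, mul_sum, mul_assoc]

lemma ip_comm (e P : Vec N nI nO) : ip e P = ip P e := by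
  simp [ip, mul_comm]

lemma ip_sub_right (e P Q : Vec N nI nO) : ip e (P - Q) = ip e P - ip e Q := by
  rw [ip_comm, ip_sub_left, ip_comm P, ip_comm Q]

lemma ip_smul_right (c : ℝ) (e P : Vec N nI nO) : ip e (c • P) = c * ip e P := by
  rw [ip_comm, ip_smul_left, ip_comm P]

lemma ip_single (x : Fin N → Fin nI) (a : Fin N → Fin nO) (c : ℝ) (P : Vec N nI nO) :
    ip (Pi.single x (Pi.single a c)) P = c * P x a := by
  unfold ip
  rw [sum_eq_single x (fun y _ hy => by simp [Pi.single_eq_of_ne hy]) (by simp),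
    sum_eq_single a (fun b _ hb => by simp [Pi.single_eq_of_ne hb]) (by simp)]
  simp

lemma ip_sum_left {ι : Type*} (s : Finset ι) (f : ι → Vec N nI nO) (P : Vec N nI nO) :
    ip (∑ i ∈ s, f i) P = ∑ i ∈ s, ip (f i) P := by
  classical
  induction s using Finset.induction_on with
  | empty => simp [ip]
  | insert i s hi ih => rw [sum_insert hi, sum_insert hi, ip_add_left, ih]

lemma ip_mono_left {e f P : Vec N nI nO} (h : ∀ x a, e x a ≤ f x a) (hP : ∀ x a, 0 ≤ P x a) :
    ip e P ≤ ip f P :=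
  sum_le_sum fun x _ => sum_le_sum fun a _ => mul_le_mul_of_nonneg_right (h x a) (hP x a)

lemma ip_nonneg {e P : Vec N nI nO} (he : ∀ x a, 0 ≤ e x a) (hP : ∀ x a, 0 ≤ P x a) :
    0 ≤ ip e P :=
  sum_nonneg fun x _ => sum_nonneg fun a _ => mul_nonneg (he x a) (hP x a)

lemma single_apply_le_ip {e P : Vec N nI nO} (he : ∀ x a, 0 ≤ e x a) (hP : ∀ x a, 0 ≤ P x a)
    (x : Fin N → Fin nI) (a : Fin N → Fin nO) : e x a * P x a ≤ ip e P :=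
  (single_le_sum (f := fun b => e x b * P x b)
      (fun b _ => mul_nonneg (he x b) (hP x b)) (mem_univ a)).trans
    (single_le_sum (f := fun y => ∑ b, e y b * P y b)
      (fun y _ => sum_nonneg fun b _ => mul_nonneg (he y b) (hP y b)) (mem_univ x))

lemma continuous_ip_left (P : Vec N nI nO) : Continuous fun e : Vec N nI nO => ip e P := by
  unfold ip; fun_prop

lemma isClosed_setOf_nonneg : IsClosed {f : Vec N nI nO | ∀ x a, 0 ≤ f x a} :=
  isClosed_Ici (a := (0 : Vec N nI nO))

lemma isClosed_reps (e : Vec N nI nO) :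
    IsClosed {f : Vec N nI nO | ∀ P, SNS N nI nO P → ip f P = ip e P} := by
  simp only [Set.ofPred_forall]
  exact isClosed_iInter fun P => isClosed_iInter fun _ =>
    isClosed_eq (continuous_ip_left _) continuous_const

/-- Every linear functional on `ℝ^(X × A)` is given by the standard inner product. -/
lemma exists_eq_ip (φ : Vec N nI nO →ₗ[ℝ] ℝ) : ∃ P : Vec N nI nO, ∀ f, φ f = ip f P := by
  refine ⟨fun x a => φ (Pi.single x (Pi.single a 1)), fun f => ?_⟩
  have hf : f = ∑ x, ∑ a, f x a • (Pi.single x (Pi.single a 1) : Vec N nI nO) := by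
    funext y b
    simp only [Finset.sum_apply, Pi.smul_apply, smul_eq_mul]
    rw [sum_eq_single y (fun x _ hx => by simp [Pi.single_eq_of_ne hx.symm]) (by simp),
      sum_eq_single b (fun a _ ha => by simp [Pi.single_eq_of_ne ha.symm]) (by simp)]
    simp
  conv_lhs => rw [hf]
  simp [ip]

/-- The uniformly random behaviour. -/
noncomputable def uniformState (N nI nO : ℕ) : Vec N nI nO :=
  fun _ _ => (Fintype.card (Fin N → Fin nO) : ℝ)⁻¹

lemma card_outputs_pos (hO : 0 < nO) : (0 : ℝ) < Fintype.card (Fin N → Fin nO) := by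
  have : Nonempty (Fin nO) := ⟨⟨0, hO⟩⟩
  exact_mod_cast Fintype.card_pos

lemma sns_uniformState (hO : 0 < nO) : SNS N nI nO (uniformState N nI nO) := by
  refine ⟨fun i x x' _ a => rfl, fun x a => by unfold uniformState; positivity, fun x => ?_⟩
  have := (card_outputs_pos (N := N) hO).ne'
  simp only [uniformState, sum_const, card_univ, nsmul_eq_mul]
  exact mul_inv_cancel₀ this

lemma SNS.le_one {P : Vec N nI nO} (hP : SNS N nI nO P) (x : Fin N → Fin nI)
    (a : Fin N → Fin nO) : P x a ≤ 1 :=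
  hP.2.2 x ▸ single_le_sum (f := fun b => P x b) (fun b _ => hP.2.1 x b) (mem_univ a)

/-- Non-negative vectors with a prescribed value on the uniformly random behaviour form a
compact set. -/
lemma isCompact_nonneg_ip_uniformState (hO : 0 < nO) (s : ℝ) :
    IsCompact {f : Vec N nI nO | (∀ x a, 0 ≤ f x a) ∧ ip f (uniformState N nI nO) = s} := by
  refine IsCompact.of_isClosed_subset (isCompact_Icc (a := (0 : Vec N nI nO))
    (b := fun _ _ => s * Fintype.card (Fin N → Fin nO))) ?_ ?_
  · exact isClosed_setOf_nonneg.inter (isClosed_eq (continuous_ip_left _) continuous_const)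
  · rintro f ⟨hf, hs⟩
    refine ⟨fun x a => hf x a, fun x a => ?_⟩
    have h := single_apply_le_ip hf (sns_uniformState (N := N) (nI := nI) hO).2.1 x a
    rw [hs, uniformState, ← div_eq_mul_inv] at h
    exact (div_le_iff₀ (card_outputs_pos hO)).1 h

/-- The non-negative representations of an effect vector. -/
def nonnegReps (e : Vec N nI nO) : Set (Vec N nI nO) :=
  {f | (∀ x a, 0 ≤ f x a) ∧ ∀ P, SNS N nI nO P → ip f P = ip e P}

lemma isCompact_nonnegReps (hO : 0 < nO) (e : Vec N nI nO) : IsCompact (nonnegReps e) :=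
  (isCompact_nonneg_ip_uniformState hO (ip e (uniformState N nI nO))).of_isClosed_subset
    (isClosed_setOf_nonneg.inter (isClosed_reps e))
      fun _ hf => ⟨hf.1, hf.2 _ (sns_uniformState hO)⟩

/-- A vector orthogonal to the annihilator of the state space is no-signalling. -/
lemma noSig_of_forall_ip_eq_zero {Q : Vec N nI nO}
    (hQ : ∀ w : Vec N nI nO, (∀ P, SNS N nI nO P → ip w P = 0) → ip w Q = 0) :
    NoSig N nI nO Q := by
  intro i x x' hx a
  have key (P : Vec N nI nO) :
      ip (∑ b, (Pi.single x (Pi.single (Function.update a i b) 1) : Vec N nI nO) -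
        ∑ b, Pi.single x' (Pi.single (Function.update a i b) 1)) P =
      ∑ b, P x (Function.update a i b) - ∑ b, P x' (Function.update a i b) := by
    simp [ip_sub_left, ip_sum_left, ip_single]
  have h := hQ _ fun P hP => (key P).trans (sub_eq_zero.2 (hP.1 i x x' hx a))
  exact sub_eq_zero.1 ((key Q).symm.trans h)

lemma ip_single_one (x : Fin N → Fin nI) (P : Vec N nI nO) :
    ip (Pi.single x 1) P = ∑ a, P x a := by
  unfold ip
  rw [sum_eq_single x (fun y _ hy => by simp [Pi.single_eq_of_ne hy]) (by simp)]
  simp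

/-- A vector orthogonal to the annihilator of the state space has the same total weight for
every input. -/
lemma sum_eq_sum_of_forall_ip_eq_zero {Q : Vec N nI nO}
    (hQ : ∀ w : Vec N nI nO, (∀ P, SNS N nI nO P → ip w P = 0) → ip w Q = 0)
    (x x' : Fin N → Fin nI) : ∑ a, Q x a = ∑ a, Q x' a := by
  have h := hQ (Pi.single x 1 - Pi.single x' 1) fun P hP => by
    simp [ip_sub_left, ip_single_one, hP.2.2]
  simpa [ip_sub_left, ip_single_one, sub_eq_zero] using h

/-- A vector that is non-negative on states is non-negative on the non-negative part of the
span of the state space. -/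
lemma ip_nonneg_of_forall_ip_eq_zero (hI : 0 < nI) {e Q : Vec N nI nO}
    (he : ∀ P, SNS N nI nO P → 0 ≤ ip e P)
    (hQ : ∀ w : Vec N nI nO, (∀ P, SNS N nI nO P → ip w P = 0) → ip w Q = 0)
    (hQ0 : ∀ x a, 0 ≤ Q x a) : 0 ≤ ip e Q := by
  let x₀ : Fin N → Fin nI := fun _ => ⟨0, hI⟩
  have hsum x : ∑ a, Q x a = ∑ a, Q x₀ a := sum_eq_sum_of_forall_ip_eq_zero hQ x x₀
  rcases (sum_nonneg fun a _ => hQ0 x₀ a : 0 ≤ ∑ a, Q x₀ a).eq_or_lt with h0 | hpos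
  · have hzero x a : Q x a = 0 :=
      (sum_eq_zero_iff_of_nonneg fun b _ => hQ0 x b).1 ((hsum x).trans h0.symm) a (mem_univ a)
    simp [ip, hzero]
  · set m := ∑ a, Q x₀ a
    have hS : SNS N nI nO (m⁻¹ • Q) := by
      refine ⟨fun i x x' hx a => ?_, fun x a => mul_nonneg (by positivity) (hQ0 x a), fun x => ?_⟩
      · simp only [Pi.smul_apply, smul_eq_mul, ← mul_sum]
        rw [noSig_of_forall_ip_eq_zero hQ i x x' hx a]
      · simp only [Pi.smul_apply, smul_eq_mul, ← mul_sum]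
        rw [hsum x, inv_mul_cancel₀ hpos.ne']
    have h := he _ hS
    rw [ip_smul_right] at h
    exact nonneg_of_mul_nonneg_right h (by positivity)

lemma convex_nonneg_ip (P : Vec N nI nO) (s : ℝ) :
    Convex ℝ {f : Vec N nI nO | (∀ x a, 0 ≤ f x a) ∧ ip f P = s} := by
  rintro f ⟨hf, hfs⟩ g ⟨hg, hgs⟩ a b ha hb hab
  refine ⟨fun x y => add_nonneg (mul_nonneg ha (hf x y)) (mul_nonneg hb (hg x y)), ?_⟩
  rw [ip_add_left, ip_smul_left, ip_smul_left, hfs, hgs, ← add_mul, hab, one_mul]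

/-- A linear functional that is non-negative on the state space has a non-negative
representation. -/
lemma nonnegReps_nonempty (hI : 0 < nI) (hO : 0 < nO) {e : Vec N nI nO}
    (he : ∀ P, SNS N nI nO P → 0 ≤ ip e P) : (nonnegReps e).Nonempty := by
  have hU := sns_uniformState (N := N) (nI := nI) hO
  have hn := card_outputs_pos (N := N) hO
  set U := uniformState N nI nO
  have hUx x a : U x a = (Fintype.card (Fin N → Fin nO) : ℝ)⁻¹ := rfl
  set n : ℝ := (Fintype.card (Fin N → Fin nO) : ℝ)
  rcases (he U hU).eq_or_lt with hs | hs
  · refine ⟨0, fun _ _ => le_rfl, fun P hP => ?_⟩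
    have h : 0 ≤ ip e (U - n⁻¹ • P) := by
      refine ip_nonneg_of_forall_ip_eq_zero hI he (fun w hw => ?_) fun x a => ?_
      · rw [ip_sub_right, ip_smul_right, hw U hU, hw P hP, mul_zero, sub_zero]
      · have := mul_le_mul_of_nonneg_left (hP.le_one x a) (inv_pos.2 hn).le
        simp only [Pi.sub_apply, Pi.smul_apply, smul_eq_mul, hUx]
        linarith
    rw [ip_sub_right, ip_smul_right, ← hs, zero_sub, neg_nonneg] at h
    have h' : ip e P ≤ 0 := nonpos_of_mul_nonpos_right h (inv_pos.2 hn)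
    rw [le_antisymm h' (he P hP)]
    simp [ip]
  · by_contra hne
    let D : Set (Vec N nI nO) := {f | (∀ x a, 0 ≤ f x a) ∧ ip f U = ip e U}
    let T : Set (Vec N nI nO) := {f | ∀ P, SNS N nI nO P → ip f P = ip e P}
    have hTconv : Convex ℝ T := fun f hf g hg a b _ _ hab P hP => by
      rw [ip_add_left, ip_smul_left, ip_smul_left, hf P hP, hg P hP, ← add_mul, hab, one_mul]
    have hdisj : Disjoint D T :=
      Set.disjoint_left.2 fun f hfD hfT => hne ⟨f, hfD.1, hfT⟩
    obtain ⟨φ, u, v, hφD, huv, hφT⟩ := geometric_hahn_banach_compact_closed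
      (convex_nonneg_ip U (ip e U)) (isCompact_nonneg_ip_uniformState hO (ip e U))
      hTconv (isClosed_reps e) hdisj
    obtain ⟨P, hP⟩ := exists_eq_ip φ.toLinearMap
    have hPφ f : φ f = ip f P := hP f
    have hw (w : Vec N nI nO) (hw : ∀ P, SNS N nI nO P → ip w P = 0) : ip w P = 0 := by
      by_contra h0
      have h := hφT (e + ((v - ip e P) / ip w P) • w) fun P hP => by
        rw [ip_add_left, ip_smul_left, hw P hP, mul_zero, add_zero]
      rw [hPφ, ip_add_left, ip_smul_left, div_mul_cancel₀ _ h0] at h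
      linarith
    have h : 0 ≤ ip e ((u / ip e U) • U - P) := by
      refine ip_nonneg_of_forall_ip_eq_zero hI he (fun w hw' => ?_) fun x a => ?_
      · rw [ip_sub_right, ip_smul_right, hw w hw', hw' U hU, mul_zero, sub_zero]
      · have hD : (Pi.single x (Pi.single a (n * ip e U)) : Vec N nI nO) ∈ D := by
          refine ⟨fun y b => ?_, ?_⟩
          · have : (0 : Vec N nI nO) ≤ Pi.single x (Pi.single a (n * ip e U)) :=
              Pi.single_nonneg.2 (Pi.single_nonneg.2 (by positivity))
            exact this y b
          · rw [ip_single, hUx]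
            field_simp
        have h := hφD _ hD
        rw [hPφ, ip_single] at h
        simp only [Pi.sub_apply, Pi.smul_apply, smul_eq_mul, hUx, sub_nonneg]
        rw [div_mul_eq_mul_div, le_div_iff₀ hs, ← div_eq_mul_inv, le_div_iff₀ hn]
        linarith
    have hlt := hφT e fun _ _ => rfl
    rw [hPφ] at hlt
    rw [ip_sub_right, ip_smul_right, div_mul_cancel₀ _ hs.ne'] at h
    linarith

lemma isEffect_of_le {f u : Vec N nI nO} (hf : ∀ x a, 0 ≤ f x a) (hfu : ∀ x a, f x a ≤ u x a)
    (hu : ∀ P, SNS N nI nO P → ip u P = 1) : IsEffect N nI nO f := fun P hP =>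
  ⟨ip_nonneg hf hP.2.1, hu P hP ▸ ip_mono_left hfu hP.2.1⟩

lemma IsExtremalEffect.ip_eq_of_convex_combination {e f₁ f₂ : Vec N nI nO}
    (he : IsExtremalEffect N nI nO e) (h₁ : IsEffect N nI nO f₁) (h₂ : IsEffect N nI nO f₂)
    {α β : ℝ} (hα : 0 < α) (hβ : 0 < β) (hαβ : α + β = 1)
    (h : ∀ P, SNS N nI nO P → ip (α • f₁ + β • f₂) P = ip e P) (P : Vec N nI nO)
    (hP : SNS N nI nO P) : ip f₁ P = ip e P ∧ ip f₂ P = ip e P := by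
  refine he.2 f₁ f₂ α h₁ h₂ hα (by linarith) (fun P hP => ?_) P hP
  rw [← h P hP, ip_add_left, ip_smul_left, ip_smul_left, ← hαβ, add_sub_cancel_left]

end Helpers

theorem extremal_effect_from_extremal_identity (N nI nO : ℕ)
    (hN : 0 < N) (hI : 0 < nI) (hO : 0 < nO)
    (e : (Fin N → Fin nI) → (Fin N → Fin nO) → ℝ)
    (he : IsExtremalEffect N nI nO e) :
    ∃ u ∈ Set.extremePoints ℝ
        {u : (Fin N → Fin nI) → (Fin N → Fin nO) → ℝ |
          (∀ x a, 0 ≤ u x a) ∧ ∀ P, SNS N nI nO P → ip u P = 1},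
      ∃ e' : (Fin N → Fin nI) → (Fin N → Fin nO) → ℝ,
        (∀ x a, e' x a = 0 ∨ e' x a = u x a) ∧
        (∀ P, SNS N nI nO P → ip e' P = ip e P) := by
  let one : Vec N nI nO := Pi.single (fun _ => ⟨0, hI⟩) 1
  have hone P (hP : SNS N nI nO P) : ip one P = 1 := by rw [ip_single_one, hP.2.2]
  obtain ⟨f, hf⟩ := (isCompact_nonnegReps hO e).extremePoints_nonempty
    (nonnegReps_nonempty hI hO fun P hP => (he.1 P hP).1)
  obtain ⟨g, hg⟩ := (isCompact_nonnegReps hO (one - e)).extremePoints_nonempty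
    (nonnegReps_nonempty hI hO fun P hP => by
      rw [ip_sub_left, hone P hP]; linarith [(he.1 P hP).2])
  obtain ⟨⟨hf0, hfe⟩, hfext⟩ := mem_extremePoints_iff_left.1 hf
  obtain ⟨⟨hg0, hge⟩, hgext⟩ := mem_extremePoints_iff_left.1 hg
  have hfg P (hP : SNS N nI nO P) : ip (f + g) P = 1 := by
    rw [ip_add_left, hfe P hP, hge P hP, ip_sub_left, hone P hP]; ring
  refine ⟨f + g, mem_extremePoints_iff_left.2
    ⟨⟨fun x a => add_nonneg (hf0 x a) (hg0 x a), hfg⟩, ?_⟩, f, fun x a => ?_, hfe⟩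
  · rintro u₁ ⟨hu₁, hu₁'⟩ u₂ ⟨hu₂, hu₂'⟩ ⟨α, β, hα, hβ, hαβ, hu⟩
    -- Split each `uᵢ` in the same proportions in which `f + g` is split.
    let r : Vec N nI nO := fun x a => f x a / (f x a + g x a)
    have hr0 x a : 0 ≤ r x a := div_nonneg (hf0 x a) (add_nonneg (hf0 x a) (hg0 x a))
    have hr1 x a : r x a ≤ 1 :=
      div_le_one_of_le₀ (by linarith [hg0 x a]) (add_nonneg (hf0 x a) (hg0 x a))
    have hrf : r * (f + g) = f := by
      funext x a
      exact div_mul_cancel_of_imp fun h => by linarith [hf0 x a, hg0 x a]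
    have hf12 : α • (r * u₁) + β • (r * u₂) = f := by
      rw [← mul_smul_comm, ← mul_smul_comm, ← mul_add, hu, hrf]
    have hg12 : α • (u₁ - r * u₁) + β • (u₂ - r * u₂) = g := by
      rw [smul_sub, smul_sub, sub_add_sub_comm, hu, hf12, add_sub_cancel_left]
    have hle {u : Vec N nI nO} (h : ∀ x a, 0 ≤ u x a) x a : (r * u) x a ≤ u x a :=
      mul_le_of_le_one_left (h x a) (hr1 x a)
    have hnn {u : Vec N nI nO} (h : ∀ x a, 0 ≤ u x a) x a : 0 ≤ (r * u) x a :=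
      mul_nonneg (hr0 x a) (h x a)
    have heq := he.ip_eq_of_convex_combination
      (isEffect_of_le (hnn hu₁) (hle hu₁) hu₁') (isEffect_of_le (hnn hu₂) (hle hu₂) hu₂')
      hα hβ hαβ fun P hP => by rw [hf12, hfe P hP]
    have hrep {u : Vec N nI nO} (h : ∀ x a, 0 ≤ u x a)
        (h1 : ∀ P, SNS N nI nO P → ip u P = 1)
        (h2 : ∀ P, SNS N nI nO P → ip (r * u) P = ip e P) : u - r * u ∈ nonnegReps (one - e) :=
      ⟨fun x a => sub_nonneg.2 (hle h x a), fun P hP => by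
        rw [ip_sub_left, ip_sub_left, h1 P hP, h2 P hP, hone P hP]⟩
    have hf1 : r * u₁ = f := hfext _ ⟨hnn hu₁, fun P hP => (heq P hP).1⟩ _
      ⟨hnn hu₂, fun P hP => (heq P hP).2⟩ ⟨α, β, hα, hβ, hαβ, hf12⟩
    have hg1 : u₁ - r * u₁ = g := hgext _ (hrep hu₁ hu₁' fun P hP => (heq P hP).1) _
      (hrep hu₂ hu₂' fun P hP => (heq P hP).2) ⟨α, β, hα, hβ, hαβ, hg12⟩
    rw [← hg1, hf1, add_sub_cancel]
  · by_contra! hne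
    obtain ⟨hfne, hgne⟩ := hne
    have hfpos : 0 < f x a := (hf0 x a).lt_of_ne' hfne
    have hgpos : 0 < g x a := (hg0 x a).lt_of_ne' fun h => hgne (by simp [h])
    -- Moving weight between `f` and `g` at `(x, a)` contradicts the extremality of `f`.
    let d := min (f x a) (g x a)
    have hd : 0 < d := lt_min hfpos hgpos
    let v : Vec N nI nO := Pi.single x (Pi.single a d)
    have hv0 y b : 0 ≤ v y b :=
      (Pi.single_nonneg.2 (Pi.single_nonneg.2 hd.le) : (0 : Vec N nI nO) ≤ v) y b
    have hv y b : v y b ≤ f y b ∧ v y b ≤ g y b := by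
      by_cases hy : y = x
      · subst hy
        by_cases hb : b = a
        · subst hb
          simp [v, d]
        · simp [v, Pi.single_eq_of_ne hb, hf0, hg0]
      · simp [v, Pi.single_eq_of_ne hy, hf0, hg0]
    have hmid : (1 / 2 : ℝ) • (f + v) + (1 / 2 : ℝ) • (f - v) = f := by module
    have hadd0 y b : 0 ≤ (f + v) y b := add_nonneg (hf0 y b) (hv0 y b)
    have hsub0 y b : 0 ≤ (f - v) y b := sub_nonneg.2 (hv y b).1
    have hadd : IsEffect N nI nO (f + v) :=
      isEffect_of_le hadd0 (fun y b => add_le_add_right (hv y b).2 _) hfg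
    have hsub : IsEffect N nI nO (f - v) :=
      isEffect_of_le hsub0
        (fun y b => by simp only [Pi.sub_apply, Pi.add_apply]; linarith [hv0 y b, hg0 y b]) hfg
    have heq := he.ip_eq_of_convex_combination hadd hsub (α := 1 / 2) (β := 1 / 2)
      (by norm_num) (by norm_num) (by norm_num) fun P hP => by rw [hmid, hfe P hP]
    have h := hfext _ ⟨hadd0, fun P hP => (heq P hP).1⟩ _ ⟨hsub0, fun P hP => (heq P hP).2⟩
      ⟨1 / 2, 1 / 2, by norm_num, by norm_num, by norm_num, hmid⟩
    have hva : v x a = 0 := by simpa using congrFun (congrFun h x) a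
    simp only [v, Pi.single_eq_same] at hva
    exact hd.ne' hva
end

section
/- Every deterministic wiring vector w on N parties is a {0,1}-valued vector and is an effect vector, i.e., 0 ≤ ⟨w, P⟩ ≤ 1 for every P ∈ S_NS. -/
open Finset

/-- Deterministic wiring vectors, defined recursively on the number of parties. -/
inductive IsDetWiring (nI nO : ℕ) : (N : ℕ) → ((Fin N → Fin nI) → (Fin N → Fin nO) → ℝ) → Prop
  | base (xhat : Fin nI) (T : Finset (Fin nO)) :
      IsDetWiring nI nO 1 (fun x a => if x 0 = xhat ∧ a 0 ∈ T then 1 else 0)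
  | step (m : ℕ) (hm : 1 ≤ m) (k : Fin (m + 1)) (xhat : Fin nI)
      (w : Fin nO → (Fin m → Fin nI) → (Fin m → Fin nO) → ℝ)
      (hw : ∀ b, IsDetWiring nI nO m (w b)) :
      IsDetWiring nI nO (m + 1)
        (fun x a => if x k = xhat then
          w (a k) (fun j => x (k.succAbove j)) (fun j => a (k.succAbove j)) else 0)

/-- An effect vector is a wiring if its functional on the state space is a convex
combination of functionals of deterministic wiring vectors. -/
def IsWiring (N nI nO : ℕ) (e : (Fin N → Fin nI) → (Fin N → Fin nO) → ℝ) : Prop :=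
  ∃ (n : ℕ) (w : Fin n → (Fin N → Fin nI) → (Fin N → Fin nO) → ℝ) (lam : Fin n → ℝ),
    (∀ i, IsDetWiring nI nO N (w i)) ∧ (∀ i, 0 ≤ lam i) ∧ (∑ i, lam i) = 1 ∧
    ∀ P, SNS N nI nO P → ip e P = ∑ i, lam i * ip (w i) P

/-- A sum over tuples splits into a sum over one coordinate and a sum over the others. -/
theorem sum_insertNth {m n : ℕ} (k : Fin (m + 1)) (f : (Fin (m + 1) → Fin n) → ℝ) :
    ∑ a, f a = ∑ b : Fin n, ∑ a : Fin m → Fin n, f (k.insertNth (α := fun _ => Fin n) b a) := by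
  rw [← Fintype.sum_prod_type', ← (Fin.insertNthEquiv (fun _ => Fin n) k).sum_comp]
  rfl

/-- For a no-signalling vector, changing one input preserves the total weight. -/
theorem NoSig.sum_eq_of_agree {N nI nO : ℕ} {P : (Fin N → Fin nI) → (Fin N → Fin nO) → ℝ}
    (hP : NoSig N nI nO P) (i : Fin N) {x x' : Fin N → Fin nI}
    (h : ∀ j, j ≠ i → x j = x' j) : ∑ a, P x a = ∑ a, P x' a := by
  cases N with
  | zero => exact i.elim0
  | succ m =>
    rw [sum_insertNth i, sum_insertNth i, Finset.sum_comm]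
    conv_rhs => rw [Finset.sum_comm]
    refine Finset.sum_congr rfl fun a _ => ?_
    rcases isEmpty_or_nonempty (Fin nO) with _ | ⟨⟨b₀⟩⟩
    · simp
    · simpa only [Fin.update_insertNth] using
        hP i x x' h (i.insertNth (α := fun _ => Fin nO) b₀ a)

/-- The total weight of a no-signalling vector does not depend on the inputs. -/
theorem NoSig.sum_eq {N nI nO : ℕ} {P : (Fin N → Fin nI) → (Fin N → Fin nO) → ℝ}
    (hP : NoSig N nI nO P) (x x' : Fin N → Fin nI) : ∑ a, P x a = ∑ a, P x' a := by
  have key : ∀ s : Finset (Fin N), ∑ a, P (s.piecewise x x') a = ∑ a, P x' a := by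
    intro s
    induction s using Finset.induction_on with
    | empty => simp
    | insert j s _ ih =>
      rw [← ih, Finset.piecewise_insert]
      exact hP.sum_eq_of_agree j fun l hl => Function.update_of_ne hl _ _
  simpa using key Finset.univ

/-- Fixing the input and output of one party preserves the no-signalling conditions. -/
theorem NoSig.insertNth {m nI nO : ℕ}
    {P : (Fin (m + 1) → Fin nI) → (Fin (m + 1) → Fin nO) → ℝ}
    (hP : NoSig (m + 1) nI nO P) (k : Fin (m + 1)) (xhat : Fin nI) (b : Fin nO) :
    NoSig m nI nO fun x a => P (k.insertNth (α := fun _ => Fin nI) xhat x)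
      (k.insertNth (α := fun _ => Fin nO) b a) := by
  intro i x x' h a
  have hup : ∀ c : Fin nO, k.insertNth (α := fun _ => Fin nO) b (Function.update a i c) =
      Function.update (k.insertNth (α := fun _ => Fin nO) b a) (k.succAbove i) c := by
    intro c
    exact Fin.insertNth_update (α := fun _ => Fin nO) k b i c a
  simp only [hup]
  refine hP (k.succAbove i) _ _ (fun j hj => ?_) _
  induction j using Fin.succAboveCases k with
  | x => simp
  | p j =>
    simp only [Fin.insertNth_apply_succAbove]
    exact h j fun e => hj (e ▸ rfl)

theorem IsDetWiring.eq_zero_or_one {N nI nO : ℕ}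
    {w : (Fin N → Fin nI) → (Fin N → Fin nO) → ℝ} (hw : IsDetWiring nI nO N w) :
    ∀ x a, w x a = 0 ∨ w x a = 1 := by
  induction hw with
  | base xhat T =>
    intro x a
    dsimp only
    split_ifs <;> simp
  | step m hm k xhat w hw ih =>
    intro x a
    dsimp only
    split_ifs
    · exact ih _ _ _
    · exact Or.inl rfl

/-- A deterministic wiring evaluates to at most the total weight on any nonnegative
no-signalling vector. -/
theorem IsDetWiring.ip_le_sum {N nI nO : ℕ}
    {w : (Fin N → Fin nI) → (Fin N → Fin nO) → ℝ} (hw : IsDetWiring nI nO N w) :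
    ∀ P, NoSig N nI nO P → (∀ x a, 0 ≤ P x a) → ∀ x₀, ip w P ≤ ∑ a, P x₀ a := by
  induction hw with
  | base xhat T =>
    intro P hP hnn x₀
    rw [hP.sum_eq x₀ fun _ => xhat, ip, Finset.sum_eq_single fun _ => xhat]
    · refine Finset.sum_le_sum fun a _ => ?_
      split_ifs
      · simp
      · simpa using hnn _ a
    · intro x _ hx
      have hx0 : x 0 ≠ xhat := fun h => hx (funext fun j => by rw [Subsingleton.elim j 0, h])
      simp [hx0]
    · simp
  | step m hm k xhat w hw ih =>
    intro P hP hnn x₀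
    let y : Fin m → Fin nI := fun j => x₀ (k.succAbove j)
    have hip : ip (fun x a => if x k = xhat then
          w (a k) (fun j => x (k.succAbove j)) (fun j => a (k.succAbove j)) else 0) P =
        ∑ b, ip (w b) fun x a => P (k.insertNth (α := fun _ => Fin nI) xhat x)
          (k.insertNth (α := fun _ => Fin nO) b a) := by
      simp only [ip]
      rw [sum_insertNth k, Finset.sum_eq_single xhat]
      · conv_rhs => rw [Finset.sum_comm]
        refine Finset.sum_congr rfl fun x _ => ?_
        rw [sum_insertNth k]
        simp
      · intro c _ hc
        simp [hc]
      · simp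
    rw [hip, hP.sum_eq x₀ (k.insertNth (α := fun _ => Fin nI) xhat y), sum_insertNth k]
    exact Finset.sum_le_sum fun b _ =>
      ih b _ (hP.insertNth k xhat b) (fun _ _ => hnn _ _) y

theorem detWiring_is_01_valued_effect (N nI nO : ℕ)
    (hN : 0 < N) (hI : 0 < nI) (hO : 0 < nO)
    (w : (Fin N → Fin nI) → (Fin N → Fin nO) → ℝ)
    (hw : IsDetWiring nI nO N w) :
    (∀ x a, w x a = 0 ∨ w x a = 1) ∧ IsEffect N nI nO w := by
  refine ⟨hw.eq_zero_or_one, fun P ⟨hP, hnn, hsum⟩ => ⟨?_, ?_⟩⟩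
  · refine Finset.sum_nonneg fun x _ => Finset.sum_nonneg fun a _ => mul_nonneg ?_ (hnn x a)
    rcases hw.eq_zero_or_one x a with h | h <;> simp [h]
  · exact (hw.ip_le_sum P hP hnn fun _ => ⟨0, hI⟩).trans_eq (hsum _)
end
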